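/- arXiv:0903.3179 — 2 statements merged into one kernel-verified Lean document; each statement's English description precedes it below -/
import Mathlib

section
/- For simple random walk on ℤ^d started at the origin, the expected size of the inner boundary of the range satisfies: if d = 2 there is a constant c₂ > 0 with E[|∂R(n)|] ≥ c₂ · n/(log n)² for all n ≥ 2, and for each d ≥ 3 there is a constant c_d > 0 with E[|∂R(n)|] ≥ c_d · n for all n ∈ ℕ. -/
open Real

/-- A single step of the simple random walk on `ℤ^d`: the pair `(i, b)` encodes a move by
`+eᵢ` (if `b = true`) or `-eᵢ` (if `b = false`).  The uniform distribution on `Fin d × Bool`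
corresponds to the uniform distribution on the `2d` unit vectors. -/
def step {d : ℕ} (a : Fin d × Bool) : Fin d → ℤ :=
  fun j => if j = a.1 then (if a.2 then 1 else -1) else 0

/-- The position `S(k)` of the walk started at `z` after `k` steps, driven by the
sequence of i.i.d. uniform steps `ω : Fin n → Fin d × Bool` (meaningful for `k ≤ n`). -/
def walk {d n : ℕ} (z : Fin d → ℤ) (ω : Fin n → Fin d × Bool) (k : ℕ) : Fin d → ℤ :=
  z + ∑ i ∈ Finset.univ.filter (fun i : Fin n => (i : ℕ) < k), step (ω i)

/-- Probability of an event for the `n`-step simple random walk on `ℤ^d`: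
the driving step sequences are uniform among the `(2d)^n` possibilities. -/
noncomputable def prW (d n : ℕ) (E : Set (Fin n → Fin d × Bool)) : ℝ :=
  E.ncard / (2 * d) ^ n

/-- Expectation of a random variable of the `n`-step simple random walk on `ℤ^d`. -/
noncomputable def exW (d n : ℕ) (f : (Fin n → Fin d × Bool) → ℝ) : ℝ :=
  (∑ ω : Fin n → Fin d × Bool, f ω) / (2 * d) ^ n

/-- Shannon entropy (base 2) of a random variable `X` of the `n`-step walk:
`H(X) = ∑ₐ -P[X = a] · log₂ P[X = a]`. -/
noncomputable def entW {α : Type*} (d n : ℕ) (X : (Fin n → Fin d × Bool) → α) : ℝ :=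
  ∑' a : α, -(prW d n {ω | X ω = a} * logb 2 (prW d n {ω | X ω = a}))

/-- The range `R(n) = {S(0), …, S(n)}` of the `n`-step walk started at `z`. -/
def rangeW {d n : ℕ} (z : Fin d → ℤ) (ω : Fin n → Fin d × Bool) : Finset (Fin d → ℤ) :=
  (Finset.range (n + 1)).image (walk z ω)

/-- The inner boundary `∂A` of a finite set `A ⊆ ℤ^d`: the points of `A` adjacent
(at graph distance 1, i.e. reachable by a single step) to some vertex of the complement. -/
def innerBdry {d : ℕ} (A : Finset (Fin d → ℤ)) : Finset (Fin d → ℤ) :=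
  A.filter fun x => ∃ a : Fin d × Bool, x + step a ∉ A

/-- The Euclidean (`L²`) norm on `ℤ^d`. -/
noncomputable def eNorm {d : ℕ} (x : Fin d → ℤ) : ℝ :=
  Real.sqrt (∑ i, ((x i : ℝ)) ^ 2)


namespace RandomWalk

open Finset

section Walk

variable {d : ℕ}

lemma walk_eq_sum_ite {n : ℕ} (z : Fin d → ℤ) (ω : Fin n → Fin d × Bool) (k : ℕ) :
    walk z ω k = z + ∑ i : Fin n, if (i : ℕ) < k then step (ω i) else 0 := by
  rw [walk, Finset.sum_filter]

lemma walk_append_left {k m : ℕ} (z : Fin d → ℤ) (u : Fin k → Fin d × Bool)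
    (v : Fin m → Fin d × Bool) {j : ℕ} (hj : j ≤ k) :
    walk z (Fin.append u v) j = walk z u j := by
  simp only [walk_eq_sum_ite, Fin.sum_univ_add, Fin.append_left, Fin.append_right,
    Fin.val_castAdd, Fin.val_natAdd]
  have : ∀ i : Fin m, ¬ (k + (i : ℕ) < j) := fun i => by omega
  simp [this]

lemma walk_append_right {k m : ℕ} (z : Fin d → ℤ) (u : Fin k → Fin d × Bool)
    (v : Fin m → Fin d × Bool) (j : ℕ) :
    walk z (Fin.append u v) (k + j) = walk z u k + walk 0 v j := by
  simp only [walk_eq_sum_ite, Fin.sum_univ_add, Fin.append_left, Fin.append_right,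
    Fin.val_castAdd, Fin.val_natAdd]
  have : ∀ i : Fin k, (i : ℕ) < k + j := fun i => by omega
  simp [this, add_assoc]

/-- The step opposite to a given one. -/
def flip (a : Fin d × Bool) : Fin d × Bool := (a.1, !a.2)

lemma step_flip (a : Fin d × Bool) : step (flip a) = -step a := by
  obtain ⟨i, b⟩ := a
  funext j
  simp only [step, flip, Pi.neg_apply]
  cases b <;> simp [apply_ite]

lemma flip_flip (a : Fin d × Bool) : flip (flip a) = a := by simp [flip]

lemma step_ne_zero (a : Fin d × Bool) : step a ≠ 0 := by
  intro h
  have := congrFun h a.1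
  simp only [step, Pi.zero_apply, if_true] at this
  split_ifs at this; omega

/-- Negating all the steps, as a permutation of the step sequences. -/
def flipEquiv (d n : ℕ) : (Fin n → Fin d × Bool) ≃ (Fin n → Fin d × Bool) where
  toFun u i := flip (u i)
  invFun u i := flip (u i)
  left_inv u := by simp [flip_flip]
  right_inv u := by simp [flip_flip]

lemma walk_flipEquiv {n : ℕ} (u : Fin n → Fin d × Bool) (j : ℕ) :
    walk 0 (flipEquiv d n u) j = -walk 0 u j := by
  simp [walk, flipEquiv, step_flip]

/-- Negating all the steps and reversing their order, as a permutation of the step sequences. -/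
def reverseEquiv (d n : ℕ) : (Fin n → Fin d × Bool) ≃ (Fin n → Fin d × Bool) where
  toFun u i := flip (u i.rev)
  invFun u i := flip (u i.rev)
  left_inv u := by simp [flip_flip]
  right_inv u := by simp [flip_flip]

lemma walk_reverseEquiv {n : ℕ} (u : Fin n → Fin d × Bool) {j : ℕ} (hj : j ≤ n) :
    walk 0 (reverseEquiv d n u) (n - j) = walk 0 u j - walk 0 u n := by
  have h : walk 0 (reverseEquiv d n u) (n - j)
      = -∑ i : Fin n, if j ≤ (i : ℕ) then step (u i) else 0 := by
    rw [walk_eq_sum_ite, zero_add, ← Equiv.sum_comp Fin.revPerm, ← Finset.sum_neg_distrib]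
    refine Finset.sum_congr rfl fun i _ => ?_
    have : ((Fin.rev i : Fin n) : ℕ) < n - j ↔ j ≤ (i : ℕ) := by
      rw [Fin.val_rev]; omega
    simp only [Fin.revPerm_apply, this, reverseEquiv, Equiv.coe_fn_mk, Fin.rev_rev, step_flip]
    split_ifs <;> simp
  rw [h, walk_eq_sum_ite, walk_eq_sum_ite, eq_sub_iff_add_eq, zero_add, zero_add,
    neg_add_eq_iff_eq_add, ← Finset.sum_add_distrib]
  refine Finset.sum_congr rfl fun i _ => ?_
  have := i.2
  by_cases hi : j ≤ (i : ℕ)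
  · simp [hi, not_lt.mpr hi]
  · simp [hi, not_le.mp hi]

lemma sum_append {M : Type*} [AddCommMonoid M] {α : Type*} [Fintype α] {k m : ℕ}
    (f : (Fin (k + m) → α) → M) :
    ∑ ω, f ω = ∑ u : Fin k → α, ∑ v : Fin m → α, f (Fin.append u v) := by
  rw [← Equiv.sum_comp (Fin.appendEquiv k m), Fintype.sum_prod_type]
  rfl

lemma card_filter_append {α : Type*} [Fintype α] {k m : ℕ}
    (p : (Fin (k + m) → α) → Prop) [DecidablePred p] :
    (univ.filter p).card
      = ∑ u : Fin k → α, (univ.filter fun v : Fin m → α => p (Fin.append u v)).card := by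
  simp only [Finset.card_filter]
  exact sum_append _

/-- The walk driven by `v` started at the origin visits neither the origin nor its neighbour
`step a` at any positive time. -/
abbrev Escapes {n : ℕ} (a : Fin d × Bool) (v : Fin n → Fin d × Bool) : Prop :=
  ∀ j < n, walk 0 v (j + 1) ≠ 0 ∧ walk 0 v (j + 1) ≠ step a

/-- The number of step sequences of length `n` for which the walk escapes. -/
def escapeCount (a : Fin d × Bool) (n : ℕ) : ℕ :=
  (univ.filter fun v : Fin n → Fin d × Bool => Escapes a v).card

/-- The number of step sequences of length `n` leading from the origin to `x`. -/
def endCount (x : Fin d → ℤ) (n : ℕ) : ℕ :=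
  (univ.filter fun v : Fin n → Fin d × Bool => walk 0 v n = x).card

lemma card_steps (d n : ℕ) : Fintype.card (Fin n → Fin d × Bool) = (2 * d) ^ n := by
  simp [mul_comm]

lemma escapeCount_add_le (a : Fin d × Bool) (k m : ℕ) :
    escapeCount a (k + m) ≤ escapeCount a k * (2 * d) ^ m := by
  rw [escapeCount, card_filter_append, escapeCount, Finset.card_filter, Finset.sum_mul]
  refine Finset.sum_le_sum fun u _ => ?_
  split_ifs with hu
  · rw [one_mul, ← card_steps]
    exact Finset.card_le_univ _
  · rw [zero_mul, Nat.le_zero, Finset.card_eq_zero, Finset.filter_eq_empty_iff]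
    intro v _ hv
    refine hu fun j hj => ?_
    have := hv j (by omega)
    rwa [walk_append_left _ _ _ (by omega)] at this

lemma card_escapes_flip (a : Fin d × Bool) (n : ℕ) :
    (univ.filter fun v : Fin n → Fin d × Bool =>
      ∀ j < n, walk 0 v (j + 1) ≠ -step a ∧ walk 0 v (j + 1) ≠ 0).card = escapeCount a n := by
  rw [escapeCount]
  refine Finset.card_equiv (flipEquiv d n) fun v => ?_
  simp only [Finset.mem_filter, Finset.mem_univ, true_and, walk_flipEquiv, Escapes]
  refine forall₂_congr fun j _ => ?_
  rw [ne_eq (-walk 0 v (j + 1)), neg_eq_zero, ne_eq (-walk 0 v (j + 1)), neg_eq_iff_eq_neg,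
    and_comm]

/-- The number of step sequences for which the last visit to `{0, step a}` is at a given time. -/
lemma card_last_visit (a : Fin d × Bool) (k m : ℕ) :
    (univ.filter fun ω : Fin (k + m) → Fin d × Bool =>
      (walk 0 ω k = 0 ∨ walk 0 ω k = step a) ∧
        ∀ j ≤ k + m, k < j → walk 0 ω j ≠ 0 ∧ walk 0 ω j ≠ step a).card
      ≤ (endCount (0 : Fin d → ℤ) k + endCount (step a) k) * escapeCount a m := by
  classical
  rw [card_filter_append, endCount, endCount, add_mul, Finset.card_filter, Finset.card_filter,
    Finset.sum_mul, Finset.sum_mul, ← Finset.sum_add_distrib]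
  refine Finset.sum_le_sum fun u _ => ?_
  by_cases h0 : walk 0 u k = 0
  · rw [if_pos h0, one_mul]
    refine le_trans ?_ (Nat.le_add_right _ _)
    refine Finset.card_le_card fun v hv => ?_
    simp only [Finset.mem_filter, Finset.mem_univ, true_and] at hv ⊢
    intro j hj
    have := hv.2 (k + (j + 1)) (by omega) (by omega)
    rwa [walk_append_right, h0, zero_add] at this
  by_cases h1 : walk 0 u k = step a
  · rw [if_pos h1, one_mul]
    refine le_trans ?_ (Nat.le_add_left _ _)
    rw [← card_escapes_flip]
    refine Finset.card_le_card fun v hv => ?_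
    simp only [Finset.mem_filter, Finset.mem_univ, true_and] at hv ⊢
    intro j hj
    have := hv.2 (k + (j + 1)) (by omega) (by omega)
    rw [walk_append_right, h1] at this
    refine ⟨fun h => this.1 (by rw [h, add_neg_cancel]), fun h => this.2 (by rw [h, add_zero])⟩
  · rw [if_neg h0, if_neg h1]
    simp [walk_append_left, h0, h1]

lemma last_visit_inequality (a : Fin d × Bool) (n : ℕ) :
    (2 * d) ^ n ≤ ∑ k ∈ range (n + 1),
      (endCount (0 : Fin d → ℤ) k + endCount (step a) k) * escapeCount a (n - k) := by
  classical
  let L : ℕ → Finset (Fin n → Fin d × Bool) := fun k => univ.filter fun ω =>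
    (walk 0 ω k = 0 ∨ walk 0 ω k = step a) ∧
      ∀ j ≤ n, k < j → walk 0 ω j ≠ 0 ∧ walk 0 ω j ≠ step a
  have hcover : (univ : Finset (Fin n → Fin d × Bool)) ⊆ (range (n + 1)).biUnion L := by
    intro ω _
    let T := (range (n + 1)).filter fun k => walk 0 ω k = 0 ∨ walk 0 ω k = step a
    have hT : T.Nonempty := ⟨0, by simp [T, walk]⟩
    have hmem := T.max'_mem hT
    simp only [T, Finset.mem_filter] at hmem
    refine Finset.mem_biUnion.mpr ⟨T.max' hT, hmem.1, ?_⟩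
    simp only [L, Finset.mem_filter, Finset.mem_univ, true_and]
    refine ⟨hmem.2, fun j hjn hj => ?_⟩
    by_contra hcon
    have : j ∈ T := by
      simp only [T, Finset.mem_filter, Finset.mem_range]
      exact ⟨by omega, by tauto⟩
    exact absurd (T.le_max' j this) (not_le.mpr hj)
  calc (2 * d) ^ n = (univ : Finset (Fin n → Fin d × Bool)).card := by
        rw [Finset.card_univ, card_steps]
    _ ≤ ((range (n + 1)).biUnion L).card := Finset.card_le_card hcover
    _ ≤ ∑ k ∈ range (n + 1), (L k).card := Finset.card_biUnion_le
    _ ≤ _ := Finset.sum_le_sum fun k hk => ?_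
  obtain ⟨m, rfl⟩ := Nat.exists_eq_add_of_le (Nat.lt_succ_iff.mp (Finset.mem_range.mp hk))
  rw [Nat.add_sub_cancel_left]
  convert card_last_visit a k m

/-- Time `k` is the last visit to its site, and the neighbour of that site in direction `a` is
never visited. -/
abbrev LastAndExposed {n : ℕ} (a : Fin d × Bool) (ω : Fin n → Fin d × Bool) (k : ℕ) : Prop :=
  (∀ j ≤ n, walk 0 ω j ≠ walk 0 ω k + step a) ∧
    ∀ j ≤ n, k < j → walk 0 ω j ≠ walk 0 ω k

lemma card_lastAndExposed_le_card_innerBdry {n : ℕ} (a : Fin d × Bool)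
    (ω : Fin n → Fin d × Bool) :
    ((range (n + 1)).filter (LastAndExposed a ω)).card
      ≤ (innerBdry (rangeW (0 : Fin d → ℤ) ω)).card := by
  refine Finset.card_le_card_of_injOn (walk 0 ω) (fun k hk => ?_) fun k hk l hl hkl => ?_
  · simp only [Finset.coe_filter, Finset.mem_range, Set.mem_ofPred_eq] at hk
    simp only [innerBdry, rangeW, Finset.coe_filter, Finset.mem_image, Finset.mem_range,
      Set.mem_ofPred_eq]
    refine ⟨⟨k, hk.1, rfl⟩, a, ?_⟩
    rintro ⟨j, hj, h⟩
    exact hk.2.1 j (by omega) h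
  · simp only [Finset.coe_filter, Finset.mem_range, Set.mem_ofPred_eq] at hk hl
    rcases lt_trichotomy k l with h | h | h
    · exact absurd hkl.symm (hk.2.2 l (by omega) h)
    · exact h
    · exact absurd hkl (hl.2.2 k (by omega) h)

lemma escapeCount_mul_le_card_lastAndExposed (a : Fin d × Bool) (k m : ℕ) :
    escapeCount a k * escapeCount a m ≤
      (univ.filter fun ω : Fin (k + m) → Fin d × Bool => LastAndExposed a ω k).card := by
  rw [card_filter_append, escapeCount, Finset.card_filter, Finset.sum_mul,
    ← Equiv.sum_comp (reverseEquiv d k)]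
  refine Finset.sum_le_sum fun u _ => ?_
  split_ifs with hu
  · rw [one_mul, escapeCount]
    refine Finset.card_le_card fun v hv => ?_
    simp only [Finset.mem_filter, Finset.mem_univ, true_and] at hv ⊢
    have hk : walk 0 (Fin.append u v) k = walk 0 u k := walk_append_left _ _ _ le_rfl
    have after : ∀ j ≤ k + m, k < j → walk 0 (Fin.append u v) j ≠ walk 0 u k + step a ∧
        walk 0 (Fin.append u v) j ≠ walk 0 u k := by
      intro j hj hkj
      obtain ⟨i, rfl⟩ : ∃ i, j = k + (i + 1) := ⟨j - k - 1, by omega⟩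
      rw [walk_append_right]
      have := hv i (by omega)
      exact ⟨fun h => this.2 (add_left_cancel h), fun h => this.1 (by simpa using h)⟩
    rw [LastAndExposed, hk]
    refine ⟨fun j hj => ?_, fun j hj hkj => (after j hj hkj).2⟩
    rcases lt_trichotomy j k with h | rfl | h
    · rw [walk_append_left _ _ _ h.le]
      intro hcon
      have := (hu (k - j - 1) (by omega)).2
      rw [show k - j - 1 + 1 = k - j by omega, walk_reverseEquiv u h.le, hcon] at this
      exact this (add_sub_cancel_left _ _)
    · rw [hk]
      intro hcon
      exact step_ne_zero a (by simpa using hcon)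
    · exact (after j hj h).1
  · simp

/-- The probability that the walk escapes up to time `n`. -/
noncomputable def escapeProb (a : Fin d × Bool) (n : ℕ) : ℝ :=
  escapeCount a n / (2 * d) ^ n

lemma escapeProb_nonneg (a : Fin d × Bool) (n : ℕ) : 0 ≤ escapeProb a n := by
  unfold escapeProb; positivity

lemma two_mul_dim_pos (a : Fin d × Bool) : (0 : ℝ) < 2 * d := by
  have : 0 < d := a.1.pos
  positivity

lemma escapeProb_antitone (a : Fin d × Bool) : Antitone (escapeProb a) := by
  intro k n hkn
  obtain ⟨m, rfl⟩ := Nat.exists_eq_add_of_le hkn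
  have hd := two_mul_dim_pos a
  have h : (escapeCount a (k + m) : ℝ) ≤ escapeCount a k * (2 * d) ^ m := by
    exact_mod_cast escapeCount_add_le a k m
  rw [escapeProb, escapeProb, div_le_div_iff₀ (by positivity) (by positivity), pow_add]
  calc (escapeCount a (k + m) : ℝ) * (2 * d) ^ k
      ≤ escapeCount a k * (2 * d) ^ m * (2 * d) ^ k := by gcongr
    _ = _ := by ring

lemma escapeProb_le_one (a : Fin d × Bool) (n : ℕ) : escapeProb a n ≤ 1 := by
  have hd := two_mul_dim_pos a
  rw [escapeProb, div_le_one (by positivity)]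
  have h : escapeCount a n ≤ (2 * d) ^ n := by
    rw [← card_steps]; exact Finset.card_le_univ _
  exact_mod_cast h

lemma mul_escapeProb_sq_le_exW (a : Fin d × Bool) (n : ℕ) :
    (n + 1) * escapeProb a n ^ 2 ≤
      exW d n (fun ω => ((innerBdry (rangeW (0 : Fin d → ℤ) ω)).card : ℝ)) := by
  have hd := two_mul_dim_pos a
  have hcount : ∑ k ∈ range (n + 1), escapeCount a k * escapeCount a (n - k) ≤
      ∑ ω : Fin n → Fin d × Bool, (innerBdry (rangeW (0 : Fin d → ℤ) ω)).card := by
    calc ∑ k ∈ range (n + 1), escapeCount a k * escapeCount a (n - k)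
        ≤ ∑ k ∈ range (n + 1),
            (univ.filter fun ω : Fin n → Fin d × Bool => LastAndExposed a ω k).card := by
          refine Finset.sum_le_sum fun k hk => ?_
          obtain ⟨m, rfl⟩ := Nat.exists_eq_add_of_le (Nat.lt_succ_iff.mp (Finset.mem_range.mp hk))
          rw [Nat.add_sub_cancel_left]
          exact escapeCount_mul_le_card_lastAndExposed a k m
      _ = ∑ ω : Fin n → Fin d × Bool, ((range (n + 1)).filter (LastAndExposed a ω)).card := by
          simp only [Finset.card_filter]
          exact Finset.sum_comm
      _ ≤ _ := Finset.sum_le_sum fun ω _ => card_lastAndExposed_le_card_innerBdry a ω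
  have hcount' : ∑ k ∈ range (n + 1), (escapeCount a k * escapeCount a (n - k) : ℝ) ≤
      ∑ ω : Fin n → Fin d × Bool, ((innerBdry (rangeW (0 : Fin d → ℤ) ω)).card : ℝ) := by
    exact_mod_cast hcount
  calc ((n : ℝ) + 1) * escapeProb a n ^ 2
      = ∑ k ∈ range (n + 1), escapeProb a n ^ 2 := by simp
    _ ≤ ∑ k ∈ range (n + 1), (escapeCount a k * escapeCount a (n - k) : ℝ) / (2 * d) ^ n := by
        refine Finset.sum_le_sum fun k hk => ?_
        have hk' : k ≤ n := Nat.lt_succ_iff.mp (Finset.mem_range.mp hk)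
        have h1 := escapeProb_antitone a hk'
        have h2 := escapeProb_antitone a (Nat.sub_le n k)
        have h0 := escapeProb_nonneg a n
        calc escapeProb a n ^ 2 ≤ escapeProb a k * escapeProb a (n - k) := by
              rw [sq]; exact mul_le_mul h1 h2 h0 (h0.trans h1)
          _ = _ := by
              rw [escapeProb, escapeProb, div_mul_div_comm, ← pow_add, Nat.add_sub_cancel' hk']
    _ ≤ _ := by
        rw [← Finset.sum_div, exW]
        gcongr

/-- Splitting at the last visit to a pair of neighbours: a bound `ρ` on the probability of being
at a given site yields a lower bound on the escape probability. -/
lemma one_le_escapeProb_mul_sum_add_sum (a : Fin d × Bool) (ρ : ℕ → ℝ)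
    (hρ : ∀ (x : Fin d → ℤ) (k : ℕ), (endCount x k : ℝ) ≤ (2 * d) ^ k * ρ k) (n m : ℕ) :
    1 ≤ escapeProb a n * (2 * ∑ k ∈ range (m + 1), ρ k) +
      2 * ∑ k ∈ Ico (m + 1) (n + m + 1), ρ k := by
  have hd := two_mul_dim_pos a
  have hρ0 : ∀ k, 0 ≤ ρ k := fun k =>
    nonneg_of_mul_nonneg_right ((Nat.cast_nonneg _).trans (hρ 0 k)) (by positivity)
  have hlast : ((2 * d : ℝ)) ^ (n + m) ≤ ∑ k ∈ range (n + m + 1),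
      ((endCount (0 : Fin d → ℤ) k + endCount (step a) k) * escapeCount a (n + m - k) : ℝ) := by
    exact_mod_cast last_visit_inequality a (n + m)
  have hterm : ∀ k ∈ range (n + m + 1),
      ((endCount (0 : Fin d → ℤ) k + endCount (step a) k) * escapeCount a (n + m - k) : ℝ)
        ≤ (2 * d) ^ (n + m) * (2 * ρ k * escapeProb a (n + m - k)) := by
    intro k hk
    have hk' : k ≤ n + m := Nat.lt_succ_iff.mp (Finset.mem_range.mp hk)
    have e : (escapeCount a (n + m - k) : ℝ)
        = (2 * d) ^ (n + m - k) * escapeProb a (n + m - k) := by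
      rw [escapeProb]; field_simp
    calc ((endCount (0 : Fin d → ℤ) k + endCount (step a) k) * escapeCount a (n + m - k) : ℝ)
        ≤ ((2 * d) ^ k * ρ k + (2 * d) ^ k * ρ k) * escapeCount a (n + m - k) := by
          gcongr <;> exact hρ _ _
      _ = ((2 * d) ^ k * (2 * d) ^ (n + m - k)) * (2 * ρ k * escapeProb a (n + m - k)) := by
          rw [e]; ring
      _ = _ := by rw [← pow_add, Nat.add_sub_cancel' hk']
  have hone : 1 ≤ ∑ k ∈ range (n + m + 1), 2 * ρ k * escapeProb a (n + m - k) := by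
    have := hlast.trans (Finset.sum_le_sum hterm)
    rw [← Finset.mul_sum] at this
    exact le_of_mul_le_mul_left (by simpa using this) (by positivity : (0 : ℝ) < (2 * d) ^ (n + m))
  rw [← Finset.sum_range_add_sum_Ico _ (by omega : m + 1 ≤ n + m + 1)] at hone
  refine hone.trans (add_le_add ?_ ?_)
  · rw [Finset.mul_sum, Finset.mul_sum]
    refine Finset.sum_le_sum fun k hk => ?_
    have hk' := Finset.mem_range.mp hk
    have := escapeProb_antitone a (by omega : n ≤ n + m - k)
    rw [mul_comm]
    exact mul_le_mul_of_nonneg_right this (by linarith [hρ0 k])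
  · rw [Finset.mul_sum]
    refine Finset.sum_le_sum fun k _ => ?_
    exact mul_le_of_le_one_right (by linarith [hρ0 k]) (escapeProb_le_one a _)

end Walk

section LocalBound

lemma centralBinom_sq_mul_le (j : ℕ) : j.centralBinom ^ 2 * (2 * j + 1) ≤ 16 ^ j := by
  induction j with
  | zero => simp
  | succ j ih =>
    have h := Nat.succ_mul_centralBinom_succ j
    have hpos : 0 < (j + 1) ^ 2 := by positivity
    refine Nat.le_of_mul_le_mul_left ?_ hpos
    calc (j + 1) ^ 2 * ((j + 1).centralBinom ^ 2 * (2 * (j + 1) + 1))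
        = ((j + 1) * (j + 1).centralBinom) ^ 2 * (2 * j + 3) := by ring
      _ = 4 * ((2 * j + 1) * (2 * j + 3)) * (j.centralBinom ^ 2 * (2 * j + 1)) := by
          rw [h]; ring
      _ ≤ 4 * (4 * (j + 1) ^ 2) * 16 ^ j := by
          have h4 : (2 * j + 1) * (2 * j + 3) ≤ 4 * (j + 1) ^ 2 := by nlinarith
          exact Nat.mul_le_mul (Nat.mul_le_mul_left 4 h4) ih
      _ = _ := by ring

lemma choose_middle_sq_mul_le (N : ℕ) : N.choose (N / 2) ^ 2 * (N + 1) ≤ 4 ^ N := by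
  rcases Nat.even_or_odd' N with ⟨j, rfl | rfl⟩
  · have := centralBinom_sq_mul_le j
    rw [Nat.centralBinom] at this
    rw [Nat.mul_div_cancel_left _ (by norm_num), pow_mul]
    exact this
  · have h := centralBinom_sq_mul_le (j + 1)
    have e : (j + 1).centralBinom = 2 * (2 * j + 1).choose j := by
      rw [Nat.centralBinom, show 2 * (j + 1) = (2 * j + 1) + 1 by ring, Nat.choose_succ_succ,
        Nat.choose_symm_half]
      ring
    rw [e] at h
    have e2 : (2 * j + 1) / 2 = j := by omega
    rw [e2]
    have : 4 ^ (2 * j + 1) * 4 = 16 ^ (j + 1) := by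
      rw [show (16 : ℕ) = 4 ^ 2 by norm_num, ← pow_mul]; ring
    nlinarith [sq_nonneg ((2 * j + 1).choose j)]

lemma choose_le_two_pow_div_sqrt (N r : ℕ) :
    (N.choose r : ℝ) ≤ 2 ^ N * (1 / √(N + 1)) := by
  refine (Nat.cast_le.mpr (Nat.choose_le_middle r N)).trans ?_
  rw [mul_one_div, le_div_iff₀ (by positivity)]
  refine le_of_sq_le_sq ?_ (by positivity)
  rw [mul_pow, Real.sq_sqrt (by positivity), ← pow_mul, mul_comm N 2, pow_mul]
  have := choose_middle_sq_mul_le N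
  norm_num1
  exact_mod_cast this

variable {d : ℕ}

/-- The times at which the walk moves in direction `i`. -/
def times {n : ℕ} (s : Fin n → Fin d) (i : Fin d) : Finset (Fin n) :=
  univ.filter fun j => s j = i

lemma walk_apply {n : ℕ} (s : Fin n → Fin d) (b : Fin n → Bool) (i : Fin d) :
    walk 0 (fun j => (s j, b j)) n i
      = 2 * ((times s i).filter fun j => b j = true).card - (times s i).card := by
  have h1 : walk 0 (fun j => (s j, b j)) n i
      = ∑ j ∈ times s i, if b j = true then (1 : ℤ) else -1 := by
    simp only [walk, Fin.is_lt, Finset.filter_true, zero_add, Finset.sum_apply, step, times,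
      Finset.sum_filter, eq_comm]
  rw [h1, Finset.card_filter, Finset.card_eq_sum_ones]
  push_cast
  rw [Finset.mul_sum, ← Finset.sum_sub_distrib]
  refine Finset.sum_congr rfl fun j _ => ?_
  split_ifs <;> norm_num

lemma card_signs_le {n : ℕ} (x : Fin d → ℤ) (s : Fin n → Fin d) :
    (univ.filter fun b : Fin n → Bool => walk 0 (fun j => (s j, b j)) n = x).card
      ≤ ∏ i, (times s i).card.choose ((x i + (times s i).card) / 2).toNat := by
  simp only [← Finset.card_powersetCard]
  rw [← Fintype.card_piFinset]
  refine Finset.card_le_card_of_injOn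
    (fun b i => (times s i).filter fun j => b j = true) (fun b hb => ?_) fun b _ b' _ h => ?_
  · simp only [Finset.coe_filter, Finset.mem_univ, true_and, Set.mem_ofPred_eq] at hb
    simp only [Finset.mem_coe, Fintype.mem_piFinset, Finset.mem_powersetCard]
    refine fun i => ⟨Finset.filter_subset _ _, ?_⟩
    have := walk_apply s b i
    rw [hb] at this
    omega
  · funext j
    have hj := congrArg (fun A => j ∈ A) (congrFun h (s j))
    simp only [Finset.mem_filter, times, Finset.mem_univ, true_and, eq_iff_iff] at hj
    exact Bool.eq_iff_iff.mpr hj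

lemma sum_card_times {n : ℕ} (s : Fin n → Fin d) : ∑ i, (times s i).card = n := by
  have := Finset.card_eq_sum_card_fiberwise (f := s) (s := univ) (t := univ) (by simp)
  simpa [times] using this.symm

lemma endCount_le_sum_prod (x : Fin d → ℤ) (n : ℕ) :
    (endCount x n : ℝ) ≤
      2 ^ n * ∑ s : Fin n → Fin d, ∏ i, 1 / √((times s i).card + 1 : ℝ) := by
  have h : endCount x n = ∑ s : Fin n → Fin d,
      (univ.filter fun b : Fin n → Bool => walk 0 (fun j => (s j, b j)) n = x).card := by
    simp only [endCount, Finset.card_filter]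
    rw [← Equiv.sum_comp (Equiv.arrowProdEquivProdArrow (Fin n) (fun _ => Fin d)
      (fun _ => Bool)).symm, Fintype.sum_prod_type]
    rfl
  rw [h, Nat.cast_sum, Finset.mul_sum]
  refine Finset.sum_le_sum fun s _ => ?_
  calc _ ≤ ((∏ i, (times s i).card.choose ((x i + (times s i).card) / 2).toNat : ℕ) : ℝ) :=
        Nat.cast_le.mpr (card_signs_le x s)
    _ ≤ ∏ i, (2 ^ (times s i).card * (1 / √((times s i).card + 1 : ℝ))) := by
        push_cast
        exact Finset.prod_le_prod (fun _ _ => by positivity)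
          fun i _ => choose_le_two_pow_div_sqrt _ _
    _ = _ := by
        rw [Finset.prod_mul_distrib, Finset.prod_pow_eq_pow_sum, sum_card_times]

/-- Size-biasing identity for the binomial number of steps in direction `i`. -/
lemma sum_card_times_mul (i : Fin d) (n : ℕ) (g : ℕ → ℝ) :
    ∑ s : Fin (n + 1) → Fin d, ((times s i).card : ℝ) * g (times s i).card
      = (n + 1) * ∑ s : Fin n → Fin d, g ((times s i).card + 1) := by
  have key : ∀ j : Fin (n + 1), ∑ s : Fin (n + 1) → Fin d,
      (if s j = i then g (times s i).card else 0)
        = ∑ s : Fin n → Fin d, g ((times s i).card + 1) := by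
    intro j
    rw [← Equiv.sum_comp (Fin.insertNthEquiv (fun _ => Fin d) j), Fintype.sum_prod_type]
    rw [Finset.sum_eq_single i]
    · refine Finset.sum_congr rfl fun s _ => ?_
      have : (times (j.insertNth i s : Fin (n + 1) → Fin d) i).card = (times s i).card + 1 := by
        simp only [times, Finset.card_filter]
        rw [Fin.sum_univ_succAbove _ j]
        simp [add_comm]
      simp [Fin.insertNthEquiv, this]
    · intro b _ hb
      simp [Fin.insertNthEquiv, hb]
    · simp
  have : ∀ s : Fin (n + 1) → Fin d, ((times s i).card : ℝ) * g (times s i).card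
      = ∑ j, if s j = i then g (times s i).card else 0 := by
    intro s
    rw [← Finset.sum_filter, Finset.sum_const, nsmul_eq_mul]
    rfl
  simp only [this]
  rw [Finset.sum_comm, Finset.sum_congr rfl fun j _ => key j]
  simp

lemma sum_inv_card_times_le (i : Fin d) (n : ℕ) :
    ∑ s : Fin n → Fin d, 1 / ((times s i).card + 1 : ℝ) ≤ (d : ℝ) ^ n * (d / (n + 1)) := by
  have h := sum_card_times_mul i n fun N => 1 / (N : ℝ)
  have hle : ∑ s : Fin (n + 1) → Fin d, ((times s i).card : ℝ) * (1 / ((times s i).card : ℝ))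
      ≤ (d : ℝ) ^ (n + 1) := by
    refine (Finset.sum_le_card_nsmul _ _ 1 fun s _ => ?_).trans_eq (by simp)
    rw [mul_one_div]
    exact div_self_le_one _
  rw [h] at hle
  push_cast at hle
  rw [mul_div_assoc', ← pow_succ, le_div_iff₀ (by positivity), mul_comm]
  exact hle

lemma sum_inv_sq_card_times_le (i : Fin d) (n : ℕ) :
    ∑ s : Fin n → Fin d, (1 / ((times s i).card + 1 : ℝ)) ^ 2
      ≤ (d : ℝ) ^ n * (2 * d ^ 2 / (n + 1) ^ 2) := by
  have h := sum_card_times_mul i n fun N => 1 / ((N : ℝ) * (N + 1))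
  have hle : ∑ s : Fin (n + 1) → Fin d,
      ((times s i).card : ℝ) * (1 / ((times s i).card * ((times s i).card + 1) : ℝ))
      ≤ (d : ℝ) ^ (n + 1) * (d / ((n + 1 : ℕ) + 1)) := by
    refine le_trans (Finset.sum_le_sum fun s _ => ?_) (sum_inv_card_times_le i (n + 1))
    rcases (times s i).card.eq_zero_or_pos with h0 | h0
    · simp [h0]
    · have : (0 : ℝ) < (times s i).card := by exact_mod_cast h0
      refine le_of_eq ?_
      field_simp
  rw [h] at hle
  push_cast at hle
  have hsq : ∀ s : Fin n → Fin d, (1 / ((times s i).card + 1 : ℝ)) ^ 2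
      ≤ 2 * (1 / (((times s i).card + 1) * ((times s i).card + 1 + 1))) := by
    intro s
    rw [div_pow, one_pow, mul_one_div, div_le_div_iff₀ (by positivity) (by positivity)]
    have : (0 : ℝ) ≤ (times s i).card := by positivity
    nlinarith
  calc _ ≤ ∑ s : Fin n → Fin d,
        2 * (1 / (((times s i).card + 1 : ℝ) * ((times s i).card + 1 + 1))) :=
        Finset.sum_le_sum fun s _ => hsq s
    _ = 2 / (n + 1) * ((n + 1) * ∑ s : Fin n → Fin d,
        1 / (((times s i).card + 1 : ℝ) * ((times s i).card + 1 + 1))) := by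
        rw [← Finset.mul_sum]; field_simp
    _ ≤ 2 / (n + 1) * ((d : ℝ) ^ (n + 1) * (d / (n + 1))) := by
        refine mul_le_mul_of_nonneg_left (hle.trans ?_) (by positivity)
        gcongr
        linarith
    _ = _ := by field_simp; ring

lemma cube_le {y r : ℝ} (hr : 0 < r) :
    y ^ 3 ≤ r * (y ^ 2) ^ 2 + 1 / r * y ^ 2 := by
  have hle : y ≤ r * y ^ 2 + 1 / r := by
    rw [← sub_nonneg]
    have : r * y ^ 2 + 1 / r - y = (r * y ^ 2 * r + 1 - y * r) / r := by field_simp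
    rw [this]
    refine div_nonneg ?_ hr.le
    nlinarith [sq_nonneg (y * r - 1), sq_nonneg (y * r)]
  calc y ^ 3 = y ^ 2 * y := by ring
    _ ≤ y ^ 2 * (r * y ^ 2 + 1 / r) := by gcongr
    _ = _ := by ring

lemma sum_inv_mul_sqrt_card_times_le (i : Fin d) (n : ℕ) :
    ∑ s : Fin n → Fin d, (1 / √((times s i).card + 1 : ℝ)) ^ 3
      ≤ (d : ℝ) ^ n * ((2 * d ^ 2 + d) / ((n + 1) * √(n + 1))) := by
  set r := √((n : ℝ) + 1)
  have hrpos : 0 < r := by positivity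
  have hpt : ∀ s : Fin n → Fin d, (1 / √((times s i).card + 1 : ℝ)) ^ 3
      ≤ r * (1 / ((times s i).card + 1 : ℝ)) ^ 2 + 1 / r * (1 / ((times s i).card + 1 : ℝ)) := by
    intro s
    have h : 1 / ((times s i).card + 1 : ℝ) = (1 / √((times s i).card + 1 : ℝ)) ^ 2 := by
      rw [div_pow, Real.sq_sqrt (by positivity), one_pow]
    rw [h]
    exact cube_le hrpos
  refine (Finset.sum_le_sum fun s _ => hpt s).trans ?_
  rw [Finset.sum_add_distrib, ← Finset.mul_sum, ← Finset.mul_sum]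
  calc _ ≤ r * (d ^ n * (2 * d ^ 2 / (n + 1) ^ 2)) + 1 / r * (d ^ n * (d / ((n : ℝ) + 1))) := by
        gcongr
        · exact sum_inv_sq_card_times_le i n
        · exact sum_inv_card_times_le i n
    _ = _ := by
        have hr2 : (n : ℝ) + 1 = r ^ 2 := (Real.sq_sqrt (by positivity)).symm
        rw [hr2]; field_simp

lemma endCount_two_le (x : Fin 2 → ℤ) (n : ℕ) :
    (endCount x n : ℝ) ≤ (2 * (2 : ℕ)) ^ n * (2 / (n + 1)) := by
  refine (endCount_le_sum_prod x n).trans ?_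
  rw [mul_pow, mul_assoc]
  refine mul_le_mul_of_nonneg_left ?_ (by positivity)
  have hpt : ∀ s : Fin n → Fin 2, ∏ i, 1 / √((times s i).card + 1 : ℝ)
      ≤ 1 / 2 * (1 / ((times s 0).card + 1 : ℝ)) + 1 / 2 * (1 / ((times s 1).card + 1 : ℝ)) := by
    intro s
    have h : ∀ i, 1 / ((times s i).card + 1 : ℝ) = (1 / √((times s i).card + 1 : ℝ)) ^ 2 := by
      intro i
      rw [div_pow, Real.sq_sqrt (by positivity), one_pow]
    rw [Fin.prod_univ_two, h, h]
    nlinarith [sq_nonneg (1 / √((times s 0).card + 1 : ℝ) - 1 / √((times s 1).card + 1 : ℝ))]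
  refine (Finset.sum_le_sum fun s _ => hpt s).trans ?_
  rw [Finset.sum_add_distrib, ← Finset.mul_sum, ← Finset.mul_sum]
  have h0 := sum_inv_card_times_le (0 : Fin 2) n
  have h1 := sum_inv_card_times_le (1 : Fin 2) n
  push_cast at h0 h1 ⊢
  linarith

lemma mul_mul_le_sum_cubes {x y z : ℝ} (hx : 0 ≤ x) (hy : 0 ≤ y) (hz : 0 ≤ z) :
    x * y * z ≤ 1 / 3 * x ^ 3 + 1 / 3 * y ^ 3 + 1 / 3 * z ^ 3 := by
  have : 0 ≤ (x + y + z) * ((x - y) ^ 2 + (y - z) ^ 2 + (z - x) ^ 2) := by positivity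
  nlinarith

lemma endCount_le_of_three_le (hd : 3 ≤ d) (x : Fin d → ℤ) (n : ℕ) :
    (endCount x n : ℝ) ≤ (2 * d) ^ n * ((2 * d ^ 2 + d) / ((n + 1) * √(n + 1))) := by
  obtain ⟨i, j, k, hij, hik, hjk⟩ :=
    Finset.two_lt_card_iff.mp (show 2 < (univ : Finset (Fin d)).card by
      rw [Finset.card_univ, Fintype.card_fin]; omega)
    |>.imp fun i => Exists.imp fun j => Exists.imp fun k => fun h => h.2.2.2
  refine (endCount_le_sum_prod x n).trans ?_
  rw [mul_pow, mul_assoc]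
  refine mul_le_mul_of_nonneg_left ?_ (by positivity)
  have hpt : ∀ s : Fin n → Fin d, ∏ i, 1 / √((times s i).card + 1 : ℝ)
      ≤ 1 / 3 * (1 / √((times s i).card + 1 : ℝ)) ^ 3
        + 1 / 3 * (1 / √((times s j).card + 1 : ℝ)) ^ 3
        + 1 / 3 * (1 / √((times s k).card + 1 : ℝ)) ^ 3 := by
    intro s
    refine le_trans ?_ (mul_mul_le_sum_cubes (by positivity) (by positivity) (by positivity))
    have hprod : ∏ l ∈ {i, j, k}, 1 / √((times s l).card + 1 : ℝ)
        = 1 / √((times s i).card + 1 : ℝ) * (1 / √((times s j).card + 1 : ℝ))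
          * (1 / √((times s k).card + 1 : ℝ)) := by
      rw [Finset.prod_insert (by simp [hij, hik]), Finset.prod_insert (by simp [hjk]),
        Finset.prod_singleton, mul_assoc]
    rw [← hprod, ← Finset.prod_mul_prod_compl ({i, j, k} : Finset (Fin d))]
    refine mul_le_of_le_one_right (Finset.prod_nonneg fun _ _ => by positivity) ?_
    refine Finset.prod_le_one (fun _ _ => by positivity) fun l _ => ?_
    rw [div_le_one (by positivity), Real.one_le_sqrt]
    linarith [(Nat.cast_nonneg (times s l).card : (0 : ℝ) ≤ _)]
  refine (Finset.sum_le_sum fun s _ => hpt s).trans ?_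
  rw [Finset.sum_add_distrib, Finset.sum_add_distrib, ← Finset.mul_sum, ← Finset.mul_sum,
    ← Finset.mul_sum]
  have hi := sum_inv_mul_sqrt_card_times_le i n
  have hj := sum_inv_mul_sqrt_card_times_le j n
  have hk := sum_inv_mul_sqrt_card_times_le k n
  linarith

end LocalBound

section Escape

lemma escapeProb_two_ge (a : Fin 2 × Bool) {n : ℕ} (hn : 2 ≤ n) :
    1 / (56 * Real.log n) ≤ escapeProb a n := by
  have hn' : (2 : ℝ) ≤ n := by exact_mod_cast hn
  have hlog2 : Real.log 2 ≤ Real.log n := Real.log_le_log (by norm_num) hn'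
  have hlog : 1 / 2 ≤ Real.log n := by linarith [Real.log_two_gt_d9]
  have h := one_le_escapeProb_mul_sum_add_sum a (fun k => 2 / ((k : ℝ) + 1)) endCount_two_le n
    (8 * n)
  have hhead : ∑ k ∈ range (8 * n + 1), 2 / ((k : ℝ) + 1) ≤ 2 * (7 * Real.log n) := by
    have h1 : ∑ k ∈ range (8 * n + 1), 2 / ((k : ℝ) + 1) = 2 * (harmonic (8 * n + 1) : ℝ) := by
      simp [harmonic, Finset.mul_sum, div_eq_mul_inv]
    have h2 := harmonic_le_one_add_log (8 * n + 1)
    have h3 : Real.log ((8 * n + 1 : ℕ) : ℝ) ≤ Real.log (2 ^ 4 * n) := by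
      refine Real.log_le_log (by positivity) ?_
      push_cast
      linarith
    rw [Real.log_mul (by norm_num) (by positivity), Real.log_pow] at h3
    push_cast at h2 h3
    rw [h1]
    linarith
  have htail : ∑ k ∈ Ico (8 * n + 1) (n + 8 * n + 1), 2 / ((k : ℝ) + 1) ≤ 1 / 4 := by
    have : ∀ k ∈ Ico (8 * n + 1) (n + 8 * n + 1), 2 / ((k : ℝ) + 1) ≤ 1 / (4 * n) := by
      intro k hk
      have hk' : ((8 * n + 1 : ℕ) : ℝ) ≤ k := by exact_mod_cast (Finset.mem_Ico.mp hk).1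
      push_cast at hk'
      rw [div_le_div_iff₀ (by positivity) (by positivity)]
      linarith
    refine (Finset.sum_le_card_nsmul _ _ _ this).trans ?_
    rw [Nat.card_Ico, nsmul_eq_mul, show n + 8 * n + 1 - (8 * n + 1) = n by omega]
    refine le_of_eq ?_
    field_simp
  have h0 := escapeProb_nonneg a n
  have h4 := mul_le_mul_of_nonneg_left hhead h0
  rw [div_le_iff₀ (by positivity)]
  linarith

lemma exists_le_escapeProb {d : ℕ} (hd : 3 ≤ d) (a : Fin d × Bool) :
    ∃ c : ℝ, 0 < c ∧ ∀ n, c ≤ escapeProb a n := by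
  set ρ : ℕ → ℝ := fun k => (2 * d ^ 2 + d) / (((k : ℝ) + 1) * √((k : ℝ) + 1)) with hρ
  have hρ0 : ∀ k, 0 ≤ ρ k := fun k => by positivity
  have hsum : Summable ρ := by
    have h1 : Summable fun k : ℕ => 1 / ((k : ℝ) ^ (3 / 2 : ℝ)) :=
      Real.summable_one_div_nat_rpow.mpr (by norm_num)
    have h2 := ((summable_nat_add_iff 1).mpr h1).mul_left (2 * (d : ℝ) ^ 2 + d)
    refine h2.congr fun k => ?_
    have : (((k + 1 : ℕ) : ℝ)) ^ (3 / 2 : ℝ) = ((k : ℝ) + 1) * √((k : ℝ) + 1) := by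
      push_cast
      rw [Real.sqrt_eq_rpow, show (3 / 2 : ℝ) = 1 + 1 / 2 by norm_num,
        Real.rpow_add (by positivity), Real.rpow_one]
    rw [this, mul_one_div]
  obtain ⟨m, hm⟩ : ∃ m, ∑' k, ρ (k + (m + 1)) < 1 / 4 :=
    (((tendsto_sum_nat_add ρ).comp (Filter.tendsto_add_atTop_nat 1)).eventually_lt_const
      (by norm_num : (0 : ℝ) < 1 / 4)).exists
  set G := ∑ k ∈ range (m + 1), ρ k with hG
  have hGpos : 0 ≤ G := Finset.sum_nonneg fun k _ => hρ0 k
  refine ⟨1 / (4 * (G + 1)), by positivity, fun n => ?_⟩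
  have h := one_le_escapeProb_mul_sum_add_sum a ρ (endCount_le_of_three_le hd) n m
  have htail : ∑ k ∈ Ico (m + 1) (n + m + 1), ρ k ≤ 1 / 4 := by
    rw [Finset.sum_Ico_eq_sum_range]
    refine le_trans ?_ hm.le
    simp only [add_comm (m + 1)]
    exact ((summable_nat_add_iff (m + 1)).mpr hsum).sum_le_tsum _ fun k _ => hρ0 _
  have h0 := escapeProb_nonneg a n
  rw [div_le_iff₀ (by positivity)]
  linarith

end Escape

end RandomWalk

/-- Lower bounds on the expected size of the inner boundary of the range:
`E[|∂R(n)|] ≥ c₂ n / log² n` in dimension 2, and `E[|∂R(n)|] ≥ c_d n` in dimension `d ≥ 3`. -/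
theorem expected_boundary_lower_bound :
    (∃ c : ℝ, 0 < c ∧ ∀ n : ℕ, 2 ≤ n →
      c * n / (Real.log n) ^ 2 ≤
        exW 2 n (fun ω => ((innerBdry (rangeW (0 : Fin 2 → ℤ) ω)).card : ℝ))) ∧
    (∀ d : ℕ, 3 ≤ d → ∃ c : ℝ, 0 < c ∧ ∀ n : ℕ,
      c * n ≤ exW d n (fun ω => ((innerBdry (rangeW (0 : Fin d → ℤ) ω)).card : ℝ))) := by
  refine ⟨⟨(1 / 56) ^ 2, by norm_num, fun n hn => ?_⟩, fun d hd => ?_⟩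
  · let a : Fin 2 × Bool := (0, true)
    refine le_trans ?_ (RandomWalk.mul_escapeProb_sq_le_exW a n)
    have hlog : 0 < Real.log n := Real.log_pos (by exact_mod_cast hn)
    calc (1 / 56) ^ 2 * (n : ℝ) / Real.log n ^ 2 = n * (1 / (56 * Real.log n)) ^ 2 := by
          field_simp
      _ ≤ (n + 1) * RandomWalk.escapeProb a n ^ 2 := by
          gcongr
          · linarith
          · exact RandomWalk.escapeProb_two_ge a hn
  · let a : Fin d × Bool := (⟨0, by omega⟩, true)
    obtain ⟨c, hc, h⟩ := RandomWalk.exists_le_escapeProb hd a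
    refine ⟨c ^ 2, by positivity, fun n => ?_⟩
    refine le_trans ?_ (RandomWalk.mul_escapeProb_sq_le_exW a n)
    calc c ^ 2 * (n : ℝ) = n * c ^ 2 := mul_comm _ _
      _ ≤ (n + 1) * RandomWalk.escapeProb a n ^ 2 := by
          gcongr
          · linarith
          · exact h n
end

section
/- There exists a constant c > 0 such that for every z ∈ ℤ² with z ≠ 0 and every real r ≥ max(2‖z‖, 2), the simple random walk on ℤ² started at z satisfies P_z[ T ≤ τ_r ] ≥ c · log(r/‖z‖) / log r, where T is the hitting time of the origin and τ_r = inf{ t ≥ 0 : ‖S(t)‖ ≥ r }. -/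
open Real

open Filter Topology

lemma prW_nonneg {d n : ℕ} (E : Set (Fin n → Fin d × Bool)) : 0 ≤ prW d n E := by
  unfold prW; positivity

lemma prW_univ {d n : ℕ} (hd : d ≠ 0) : prW d n Set.univ = 1 := by
  have : (2 * (d : ℝ)) ^ n ≠ 0 := by positivity
  unfold prW
  rw [Set.ncard_univ, Nat.card_eq_fintype_card]
  simp only [Fintype.card_fun, Fintype.card_prod, Fintype.card_fin, Fintype.card_bool]
  push_cast
  rw [mul_comm (d : ℝ) 2, div_self this]

lemma prW_le_one {d n : ℕ} (hd : d ≠ 0) (E : Set (Fin n → Fin d × Bool)) : prW d n E ≤ 1 := by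
  rw [← prW_univ (n := n) hd]
  unfold prW
  gcongr
  · exact Set.finite_univ
  · exact Set.subset_univ E

/-- Conditioning on the first step. -/
lemma prW_succ {d n : ℕ} (E : Set (Fin (n + 1) → Fin d × Bool)) :
    prW d (n + 1) E = (∑ a, prW d n {ω | (Fin.cons a ω : Fin (n + 1) → Fin d × Bool) ∈ E}) /
      (2 * d) := by
  classical
  have key : E.ncard =
      ∑ a, {ω | (Fin.cons a ω : Fin (n + 1) → Fin d × Bool) ∈ E}.ncard := by
    simp only [Set.ncard_eq_toFinset_card', Set.toFinset_card, Set.mem_ofPred_eq,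
      Fintype.card_subtype, Finset.card_filter]
    rw [← Fintype.sum_prod_type']
    exact (Fintype.sum_equiv (Fin.consEquiv fun _ => Fin d × Bool) _ _ fun _ => rfl).symm
  unfold prW
  rw [key, ← Finset.sum_div, div_div, ← pow_succ]
  push_cast
  rfl

lemma walk_zero {d n : ℕ} (z : Fin d → ℤ) (ω : Fin n → Fin d × Bool) : walk z ω 0 = z := by
  simp [walk]

lemma walk_cons_succ {d n : ℕ} (z : Fin d → ℤ) (a : Fin d × Bool) (ω : Fin n → Fin d × Bool)
    (k : ℕ) :
    walk z (Fin.cons a ω : Fin (n + 1) → Fin d × Bool) (k + 1) = walk (z + step a) ω k := by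
  simp [walk, Finset.sum_filter, Fin.sum_univ_succ, add_assoc]

/-- The event that the walk hits the origin by time `m`, staying in the ball of radius `r`
until then. -/
def hitEvent {d : ℕ} (m : ℕ) (r : ℝ) (z : Fin d → ℤ) : Set (Fin m → Fin d × Bool) :=
  {ω | ∃ t ≤ m, walk z ω t = 0 ∧ ∀ s < t, eNorm (walk z ω s) < r}

lemma hitEvent_zero {d m : ℕ} {r : ℝ} : hitEvent m r (0 : Fin d → ℤ) = Set.univ :=
  Set.eq_univ_of_forall fun ω => ⟨0, Nat.zero_le _, walk_zero _ _, fun _ h => by omega⟩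

lemma cons_mem_hitEvent {d m : ℕ} {r : ℝ} {z : Fin d → ℤ} (hz : eNorm z < r) {a : Fin d × Bool}
    {ω : Fin m → Fin d × Bool} (h : ω ∈ hitEvent m r (z + step a)) :
    (Fin.cons a ω : Fin (m + 1) → Fin d × Bool) ∈ hitEvent (m + 1) r z := by
  obtain ⟨t, ht, h0, hs⟩ := h
  refine ⟨t + 1, by omega, by rwa [walk_cons_succ], fun s hst => ?_⟩
  cases s with
  | zero => rwa [walk_zero]
  | succ s => rw [walk_cons_succ]; exact hs s (by omega)

open Classical in
/-- The probability of hitting the origin within `m` steps before leaving the ball of radius `r`,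
defined by recursion on `m`. -/
noncomputable def hitProb (r : ℝ) : ℕ → (Fin 2 → ℤ) → ℝ
  | 0, x => if x = 0 then 1 else 0
  | m + 1, x => if x = 0 then 1 else if r ≤ eNorm x then 0 else
      (∑ a, hitProb r m (x + step a)) / 4

lemma hitProb_origin (r : ℝ) (m : ℕ) : hitProb r m 0 = 1 := by
  cases m <;> simp [hitProb]

lemma hitProb_succ {r : ℝ} {m : ℕ} {x : Fin 2 → ℤ} (hx : x ≠ 0) (hr : eNorm x < r) :
    hitProb r (m + 1) x = (∑ a, hitProb r m (x + step a)) / 4 := by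
  simp [hitProb, hx, hr.not_ge]

lemma hitProb_nonneg (r : ℝ) (m : ℕ) (x : Fin 2 → ℤ) : 0 ≤ hitProb r m x := by
  induction m generalizing x with
  | zero => unfold hitProb; split_ifs <;> norm_num
  | succ m ih =>
    unfold hitProb
    split_ifs
    · norm_num
    · norm_num
    · exact div_nonneg (Finset.sum_nonneg fun a _ => ih _) (by norm_num)

lemma hitProb_le_succ (r : ℝ) (m : ℕ) (x : Fin 2 → ℤ) : hitProb r m x ≤ hitProb r (m + 1) x := by
  induction m generalizing x with
  | zero =>
    by_cases hx : x = 0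
    · simp [hx, hitProb_origin]
    · simpa [hitProb, hx] using hitProb_nonneg r 1 x
  | succ m ih =>
    rw [hitProb, hitProb]
    split_ifs
    · rfl
    · rfl
    · gcongr with a
      exact ih _

lemma hitProb_le_prW (r : ℝ) (m : ℕ) (x : Fin 2 → ℤ) :
    hitProb r m x ≤ prW 2 m (hitEvent m r x) := by
  induction m generalizing x with
  | zero =>
    by_cases hx : x = 0
    · subst hx
      rw [hitProb_origin, hitEvent_zero, prW_univ two_ne_zero]
    · simpa [hitProb, hx] using prW_nonneg _
  | succ m ih =>
    by_cases hx : x = 0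
    · subst hx
      rw [hitProb_origin, hitEvent_zero, prW_univ two_ne_zero]
    · rcases le_or_gt r (eNorm x) with hr | hr
      · simpa [hitProb, hx, hr] using prW_nonneg _
      · rw [hitProb_succ hx hr, prW_succ]
        norm_num only [Nat.cast_ofNat]
        gcongr with a
        refine (ih _).trans ?_
        unfold prW
        gcongr
        · exact Set.toFinite _
        · exact fun ω h => cons_mem_hitEvent hr h

/-- A function whose logarithm `log (potential x)` is superharmonic
away from the origin and comparable to `2 * log ‖x‖`. -/
noncomputable def potential (x : Fin 2 → ℤ) : ℝ :=
  if x = 0 then 1 / 126 else (x 0 : ℝ) ^ 2 + (x 1 : ℝ) ^ 2 - 1 / 2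

lemma eNorm_sq (x : Fin 2 → ℤ) : eNorm x ^ 2 = (x 0 : ℝ) ^ 2 + (x 1 : ℝ) ^ 2 := by
  rw [eNorm, Real.sq_sqrt (by positivity), Fin.sum_univ_two]

lemma potential_of_ne_zero {x : Fin 2 → ℤ} (hx : x ≠ 0) :
    potential x = eNorm x ^ 2 - 1 / 2 := by
  rw [potential, if_neg hx, eNorm_sq]

lemma one_le_eNorm_sq {x : Fin 2 → ℤ} (hx : x ≠ 0) : 1 ≤ eNorm x ^ 2 := by
  rw [eNorm_sq]
  have : 0 < x 0 ^ 2 + x 1 ^ 2 := by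
    by_contra h
    apply hx
    have h0 : x 0 = 0 := by nlinarith [sq_nonneg (x 0), sq_nonneg (x 1)]
    have h1 : x 1 = 0 := by nlinarith [sq_nonneg (x 0), sq_nonneg (x 1)]
    ext i
    fin_cases i <;> simpa
  exact_mod_cast this

lemma potential_pos (x : Fin 2 → ℤ) : 0 < potential x := by
  by_cases hx : x = 0
  · simp [potential, hx]
  · rw [potential_of_ne_zero hx]
    linarith [one_le_eNorm_sq hx]

lemma sum_step (f : (Fin 2 → ℤ) → ℝ) (x : Fin 2 → ℤ) :
    ∑ a, f (x + step a) = f ![x 0 + 1, x 1] + f ![x 0 - 1, x 1] +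
      (f ![x 0, x 1 + 1] + f ![x 0, x 1 - 1]) := by
  have h (a : Fin 2 × Bool) : x + step a = ![x 0 + step a 0, x 1 + step a 1] := by
    ext i; fin_cases i <;> rfl
  simp only [h]
  simp [Fintype.sum_prod_type, step, sub_eq_add_neg]

lemma potential_prod_le {x : Fin 2 → ℤ} (hx : x ≠ 0) :
    potential ![x 0 + 1, x 1] * potential ![x 0 - 1, x 1] *
      (potential ![x 0, x 1 + 1] * potential ![x 0, x 1 - 1]) ≤ potential x ^ 4 := by
  obtain ⟨p, hp⟩ : ∃ p, p = x 0 := ⟨_, rfl⟩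
  obtain ⟨q, hq⟩ : ∃ q, q = x 1 := ⟨_, rfl⟩
  have hpq : x = ![p, q] := by ext i; fin_cases i <;> simp [hp, hq]
  rw [← hp, ← hq]
  subst hpq
  have hne : ¬ (p = 0 ∧ q = 0) := by simpa using hx
  have hv (a b : ℤ) : (![a, b] : Fin 2 → ℤ) = 0 ↔ a = 0 ∧ b = 0 := by
    rw [funext_iff, Fin.forall_fin_two]; rfl
  by_cases h1 : p = -1 ∧ q = 0
  · obtain ⟨rfl, rfl⟩ := h1; simp only [potential, hv]; norm_num
  by_cases h2 : p = 1 ∧ q = 0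
  · obtain ⟨rfl, rfl⟩ := h2; simp only [potential, hv]; norm_num
  by_cases h3 : p = 0 ∧ q = -1
  · obtain ⟨rfl, rfl⟩ := h3; simp only [potential, hv]; norm_num
  by_cases h4 : p = 0 ∧ q = 1
  · obtain ⟨rfl, rfl⟩ := h4; simp only [potential, hv]; norm_num
  simp only [potential]
  rw [if_neg (by rw [hv]; omega), if_neg (by rw [hv]; omega), if_neg (by rw [hv]; omega),
    if_neg (by rw [hv]; omega), if_neg (by rw [hv]; omega)]
  simp only [Matrix.cons_val_zero, Matrix.cons_val_one]
  push_cast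
  nlinarith [sq_nonneg ((p : ℝ) ^ 2 - (q : ℝ) ^ 2)]

lemma log_potential_superharmonic {x : Fin 2 → ℤ} (hx : x ≠ 0) :
    ∑ a, Real.log (potential (x + step a)) ≤ 4 * Real.log (potential x) := by
  have hp (y) := (potential_pos y).ne'
  rw [sum_step fun y => Real.log (potential y), ← Real.log_mul (hp _) (hp _),
    ← Real.log_mul (hp _) (hp _), ← Real.log_mul (mul_ne_zero (hp _) (hp _))
      (mul_ne_zero (hp _) (hp _))]
  calc _ ≤ Real.log (potential x ^ 4) :=
        Real.log_le_log (mul_pos (mul_pos (potential_pos _) (potential_pos _))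
          (mul_pos (potential_pos _) (potential_pos _))) (potential_prod_le hx)
    _ = _ := by rw [Real.log_pow]; norm_num

lemma finite_eNorm_lt (r : ℝ) : {x : Fin 2 → ℤ | eNorm x < r}.Finite := by
  refine (Set.finite_Icc (fun _ => -⌈r⌉ : Fin 2 → ℤ) (fun _ => ⌈r⌉)).subset fun x hx => ?_
  have hx' : eNorm x < r := hx
  have key (i : Fin 2) : |x i| ≤ ⌈r⌉ := by
    have : |(x i : ℝ)| ≤ eNorm x :=
      Real.abs_le_sqrt (Finset.single_le_sum (f := fun i => (x i : ℝ) ^ 2)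
        (fun i _ => sq_nonneg _) (Finset.mem_univ i))
    exact_mod_cast (this.trans hx'.le).trans (Int.le_ceil r)
  exact ⟨fun i => (abs_le.mp (key i)).1, fun i => (abs_le.mp (key i)).2⟩

/-- Maximum principle for functions that are subharmonic on a finite set. -/
lemma nonpos_of_subharmonic {V : Set (Fin 2 → ℤ)} (hV : V.Finite) {f : (Fin 2 → ℤ) → ℝ}
    (hout : ∀ x ∉ V, f x ≤ 0) (hsub : ∀ x ∈ V, 4 * f x ≤ ∑ a, f (x + step a))
    (x : Fin 2 → ℤ) : f x ≤ 0 := by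
  by_contra! hx
  have hmem {y} (hy : 0 < f y) : y ∈ V := by
    by_contra h
    exact (hout y h).not_gt hy
  obtain ⟨y, hyV, hy⟩ := hV.exists_maximalFor f V ⟨x, hmem hx⟩
  have hle (w) : f w ≤ f y := by
    have hmax {v} (hv : v ∈ V) : f v ≤ f y := (le_total (f v) (f y)).elim id (hy hv)
    by_cases hw : w ∈ V
    · exact hmax hw
    · exact (hout w hw).trans (hx.le.trans (hmax (hmem hx)))
  have hypos : 0 < f y := hx.trans_le (hle x)
  have hray (k : ℕ) : f ![y 0 + k, y 1] = f y := by
    induction k with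
    | zero => congr 1; ext i; fin_cases i <;> simp
    | succ k ih =>
      have h := hsub ![y 0 + k, y 1] (hmem (ih ▸ hypos))
      rw [sum_step, ih] at h
      simp only [Matrix.cons_val_zero, Matrix.cons_val_one] at h
      push_cast
      rw [← add_assoc]
      exact le_antisymm (hle _) (by
        linarith [hle ![y 0 + k - 1, y 1], hle ![y 0 + k, y 1 + 1], hle ![y 0 + k, y 1 - 1]])
  refine Set.infinite_of_injective_forall_mem (f := fun k : ℕ => ![y 0 + k, y 1])
    (fun k l hkl => ?_) (fun k => hmem (hray k ▸ hypos)) hV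
  simpa using congrFun hkl 0

lemma potential_barrier {r : ℝ} (hr : 2 ≤ r) {U : (Fin 2 → ℤ) → ℝ} (h0 : U 0 = 1)
    (hU : ∀ x, 0 ≤ U x)
    (hharm : ∀ x ≠ 0, eNorm x < r → ∑ a, U (x + step a) = 4 * U x) (x : Fin 2 → ℤ) :
    (Real.log (r ^ 2 - 1 / 2) - Real.log (potential x)) /
      (Real.log (r ^ 2 - 1 / 2) + Real.log 126) ≤ U x := by
  have hA : 0 < Real.log (r ^ 2 - 1 / 2) := Real.log_pos (by nlinarith)
  have hB : 0 < Real.log (r ^ 2 - 1 / 2) + Real.log 126 :=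
    add_pos hA (Real.log_pos (by norm_num))
  set A := Real.log (r ^ 2 - 1 / 2)
  set B := A + Real.log 126
  rw [← sub_nonpos]
  refine nonpos_of_subharmonic (V := {x | eNorm x < r} \ {0}) ((finite_eNorm_lt r).sdiff)
    (f := fun x => (A - Real.log (potential x)) / B - U x) (fun x hx => ?_)
    (fun x hx => ?_) x
  · rw [Set.mem_sdiff, not_and_not_right] at hx
    by_cases hx0 : x = 0
    · subst hx0
      have : A - Real.log (potential 0) = B := by
        simp [potential, B]
      simp only [this, h0, div_self hB.ne', sub_self, le_refl]
    · have hxr : r ≤ eNorm x := by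
        by_contra! h
        exact hx0 (hx h)
      have : A ≤ Real.log (potential x) := by
        rw [potential_of_ne_zero hx0]
        exact Real.log_le_log (by nlinarith) (by nlinarith)
      have := div_nonpos_of_nonpos_of_nonneg (sub_nonpos.mpr this) hB.le
      linarith [hU x]
  · have hs := log_potential_superharmonic hx.2
    have hu := hharm x hx.2 hx.1
    simp only [Finset.sum_sub_distrib, ← Finset.sum_div, hu, Finset.sum_const, Finset.card_univ,
      Fintype.card_prod, Fintype.card_fin, Fintype.card_bool, mul_sub]
    gcongr
    rw [← mul_div_assoc]
    gcongr
    norm_num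
    linarith

lemma log_ratio_bound {n r : ℝ} (hn : 1 ≤ n) (hnr : 2 * n ≤ r) :
    2 / 9 * Real.log (r / n) / Real.log r ≤
      (Real.log (r ^ 2 - 1 / 2) - Real.log (n ^ 2 - 1 / 2)) /
        (Real.log (r ^ 2 - 1 / 2) + Real.log 126) := by
  have hr : 2 ≤ r := by linarith
  have hlr : Real.log 2 ≤ Real.log r := Real.log_le_log (by norm_num) hr
  have hl2 : 0 < Real.log 2 := Real.log_pos (by norm_num)
  have hnum : 2 * Real.log (r / n) ≤
      Real.log (r ^ 2 - 1 / 2) - Real.log (n ^ 2 - 1 / 2) := by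
    rw [← Real.log_div (by nlinarith) (by nlinarith)]
    calc 2 * Real.log (r / n) = Real.log ((r / n) ^ 2) := by rw [Real.log_pow]; norm_num
      _ ≤ _ := by
        apply Real.log_le_log (by positivity)
        rw [div_pow, div_le_div_iff₀ (by positivity) (by nlinarith)]
        nlinarith
  have hden : Real.log (r ^ 2 - 1 / 2) + Real.log 126 ≤ 9 * Real.log r := by
    have h1 : Real.log (r ^ 2 - 1 / 2) ≤ 2 * Real.log r := by
      calc _ ≤ Real.log (r ^ 2) := Real.log_le_log (by nlinarith) (by linarith)
        _ = _ := by rw [Real.log_pow]; norm_num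
    have h2 : Real.log 126 ≤ 7 * Real.log 2 := by
      calc _ ≤ Real.log (2 ^ 7) := Real.log_le_log (by norm_num) (by norm_num)
        _ = _ := by rw [Real.log_pow]; norm_num
    linarith
  have hlog : 0 ≤ Real.log (r / n) := Real.log_nonneg (by rw [le_div_iff₀] <;> linarith)
  have hA : 0 < Real.log (r ^ 2 - 1 / 2) := Real.log_pos (by nlinarith)
  calc 2 / 9 * Real.log (r / n) / Real.log r = 2 * Real.log (r / n) / (9 * Real.log r) := by
        have : Real.log r ≠ 0 := by linarith
        field_simp
    _ ≤ _ := div_le_div₀ (by linarith) hnum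
        (add_pos hA (Real.log_pos (by norm_num))) hden

/-- `P_z[T ≤ τ_r] ≥ c log(r/‖z‖)/log r`: the walk started at `z` hits the origin before
exiting the ball of radius `r` with at least this probability.  The probability of this
(monotone) event is expressed as the supremum over finite horizons `m` of the probability
that the walk hits `0` by time `m` while staying inside the open ball of radius `r`. -/
theorem hit_origin_before_exit :
    ∃ c : ℝ, 0 < c ∧ ∀ z : Fin 2 → ℤ, z ≠ 0 → ∀ r : ℝ, 2 * eNorm z ≤ r → 2 ≤ r →
      c * Real.log (r / eNorm z) / Real.log r ≤
        ⨆ m : ℕ, prW 2 m {ω | ∃ t ≤ m, walk z ω t = 0 ∧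
          ∀ s < t, eNorm (walk z ω s) < r} := by
  refine ⟨2 / 9, by norm_num, fun z hz r hzr hr => ?_⟩
  have hbdd (x) : BddAbove (Set.range fun m => prW 2 m (hitEvent m r x)) :=
    ⟨1, by rintro _ ⟨m, rfl⟩; exact prW_le_one two_ne_zero _⟩
  have hbdd' (x) : BddAbove (Set.range fun m => hitProb r m x) :=
    ⟨1, by rintro _ ⟨m, rfl⟩; exact (hitProb_le_prW r m x).trans (prW_le_one two_ne_zero _)⟩
  have hlim (x) : Tendsto (fun m => hitProb r m x) atTop (𝓝 (⨆ m, hitProb r m x)) :=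
    tendsto_atTop_ciSup (monotone_nat_of_le_succ fun m => hitProb_le_succ r m x) (hbdd' x)
  have hn : 1 ≤ eNorm z :=
    (one_le_sq_iff₀ (Real.sqrt_nonneg _)).mp (one_le_eNorm_sq hz)
  calc _ ≤ _ := log_ratio_bound hn hzr
    _ ≤ ⨆ m, hitProb r m z := by
      rw [← potential_of_ne_zero hz]
      refine potential_barrier hr (U := fun x => ⨆ m, hitProb r m x) ?_ ?_ ?_ z
      · simp [hitProb_origin]
      · exact fun x => Real.iSup_nonneg fun m => hitProb_nonneg r m x
      · intro x hx hxr
        have h1 := (tendsto_finsetSum Finset.univ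
          fun (a : Fin 2 × Bool) _ => hlim (x + step a)).div_const 4
        have h2 := (hlim x).comp (tendsto_add_atTop_nat 1)
        simp only [Function.comp_def, hitProb_succ hx hxr] at h2
        linarith [tendsto_nhds_unique h1 h2]
    _ ≤ _ := ciSup_mono (hbdd z) fun m => hitProb_le_prW r m z
end
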